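/- Let G be a discrete group, let ((A^(i), G, α^(i)), φ_i)_{i∈ℕ} be an inductive sequence of partial dynamical systems, and let (A, (μ_i)_{i∈ℕ}) be a concrete inductive limit of the inductive sequence of C*-algebras (A^(i), φ_i). Then there exists a unique partial action α = ({A_g}_{g∈G}, {α_g}_{g∈G}) of G on A such that for every g ∈ G the ideal A_g equals the closure of ⋃_i μ_i(A^(i)_g), and α_g(μ_i(a)) = μ_i(α^(i)_g(a)) for every i ∈ ℕ and every a ∈ A^(i)_{g⁻¹}. -/

import Mathlib

open scoped ComplexOrder

/-- A partial action of a discrete group `G` on a C*-algebra `A`, encoded elementwise: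
`I g` is the closed two-sided ideal `A_g`, and `θ g : A → A` is a (total extension of the)
*-isomorphism `α_g : A_{g⁻¹} → A_g`; all axioms are only imposed on the relevant ideals. -/
structure CStarPartialAction (G : Type*) [Group G] (A : Type*)
    [NonUnitalNormedRing A] [StarRing A] [Module ℂ A] where
  I : G → Set A
  isClosed : ∀ g, IsClosed (I g)
  zero_mem : ∀ g, (0 : A) ∈ I g
  add_mem : ∀ g, ∀ a ∈ I g, ∀ b ∈ I g, a + b ∈ I g
  smul_mem : ∀ g (c : ℂ), ∀ a ∈ I g, c • a ∈ I g
  mul_mem_left : ∀ g (x : A), ∀ a ∈ I g, x * a ∈ I g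
  mul_mem_right : ∀ g (x : A), ∀ a ∈ I g, a * x ∈ I g
  star_mem : ∀ g, ∀ a ∈ I g, star a ∈ I g
  θ : G → A → A
  mapsTo : ∀ g, ∀ a ∈ I g⁻¹, θ g a ∈ I g
  θ_add : ∀ g, ∀ a ∈ I g⁻¹, ∀ b ∈ I g⁻¹, θ g (a + b) = θ g a + θ g b
  θ_smul : ∀ g (c : ℂ), ∀ a ∈ I g⁻¹, θ g (c • a) = c • θ g a
  θ_mul : ∀ g, ∀ a ∈ I g⁻¹, ∀ b ∈ I g⁻¹, θ g (a * b) = θ g a * θ g b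
  θ_star : ∀ g, ∀ a ∈ I g⁻¹, θ g (star a) = star (θ g a)
  θ_surjOn : ∀ g, ∀ b ∈ I g, ∃ a ∈ I g⁻¹, θ g a = b
  θ_injOn : ∀ g, ∀ a ∈ I g⁻¹, ∀ b ∈ I g⁻¹, θ g a = θ g b → a = b
  I_one : I 1 = Set.univ
  θ_one : ∀ a : A, θ 1 a = a
  mem_comp : ∀ g h, ∀ x ∈ I h⁻¹, θ h x ∈ I g⁻¹ → x ∈ I (g * h)⁻¹
  θ_comp : ∀ g h, ∀ x ∈ I h⁻¹, θ h x ∈ I g⁻¹ → θ g (θ h x) = θ (g * h) x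

/-- A map `φ : A → B` is `G`-equivariant with respect to partial actions `α` on `A` and
`β` on `B` if `φ(A_g) ⊆ B_g` and `φ ∘ α_g = β_g ∘ φ` on `A_{g⁻¹}`. -/
def IsEquivariantMap {G : Type*} [Group G] {A B : Type*}
    [NonUnitalNormedRing A] [StarRing A] [Module ℂ A]
    [NonUnitalNormedRing B] [StarRing B] [Module ℂ B]
    (α : CStarPartialAction G A) (β : CStarPartialAction G B) (φ : A → B) : Prop :=
  (∀ g, φ '' α.I g ⊆ β.I g) ∧ ∀ g, ∀ a ∈ α.I g⁻¹, φ (α.θ g a) = β.θ g (φ a)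

/-- The composite `φ_{i,i+j} = φ_{i+j-1} ∘ ⋯ ∘ φ_i : A_i → A_{i+j}` of the connecting maps
of an inductive sequence. -/
def iterMap {A : ℕ → Type*} (φ : ∀ i, A i → A (i + 1)) (i : ℕ) : (j : ℕ) → A i → A (i + j)
  | 0 => id
  | j + 1 => fun a => φ (i + j) (iterMap φ i j a)

section

open Filter Topology

namespace CStarPartialAction

section Basic

variable {G : Type*} [Group G] {A : Type*} [NonUnitalCStarAlgebra A]

/-- The ideal `A_g` of a partial action, as a non-unital star subalgebra. -/
def idealSubalgebra (α : CStarPartialAction G A) (g : G) : NonUnitalStarSubalgebra ℂ A where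
  carrier := α.I g
  add_mem' ha hb := α.add_mem g _ ha _ hb
  zero_mem' := α.zero_mem g
  mul_mem' _ hb := α.mul_mem_left g _ _ hb
  smul_mem' c _ ha := α.smul_mem g c _ ha
  star_mem' ha := α.star_mem g _ ha

/-- The map `α_g` as a homomorphism from the ideal `A_{g⁻¹}`. -/
def toStarAlgHom (α : CStarPartialAction G A) (g : G) :
    α.idealSubalgebra g⁻¹ →⋆ₙₐ[ℂ] A where
  toFun x := α.θ g x
  map_smul' c x := α.θ_smul g c x x.2
  map_zero' := by
    simpa using α.θ_smul g 0 0 (α.zero_mem _)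
  map_add' x y := α.θ_add g x x.2 y y.2
  map_mul' x y := α.θ_mul g x x.2 y y.2
  map_star' x := α.θ_star g x x.2

theorem norm_θ (α : CStarPartialAction G A) (g : G) {a : A} (ha : a ∈ α.I g⁻¹) :
    ‖α.θ g a‖ = ‖a‖ := by
  have : IsClosed (α.idealSubalgebra g⁻¹ : Set A) := α.isClosed g⁻¹
  have hinj : Function.Injective (α.toStarAlgHom g) := fun x y hxy =>
    Subtype.ext (α.θ_injOn g x x.2 y y.2 hxy)
  exact NonUnitalStarAlgHom.norm_map (α.toStarAlgHom g) hinj ⟨a, ha⟩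

theorem θ_sub (α : CStarPartialAction G A) (g : G) {a b : A} (ha : a ∈ α.I g⁻¹)
    (hb : b ∈ α.I g⁻¹) : α.θ g (a - b) = α.θ g a - α.θ g b :=
  map_sub (α.toStarAlgHom g) ⟨a, ha⟩ ⟨b, hb⟩

theorem sub_mem (α : CStarPartialAction G A) (g : G) {a b : A} (ha : a ∈ α.I g)
    (hb : b ∈ α.I g) : a - b ∈ α.I g :=
  _root_.sub_mem (H := α.idealSubalgebra g) ha hb

theorem θ_inv_θ (α : CStarPartialAction G A) (g : G) {a : A} (ha : a ∈ α.I g⁻¹) :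
    α.θ g⁻¹ (α.θ g a) = a := by
  have h : α.θ g a ∈ α.I g⁻¹⁻¹ := by simpa using α.mapsTo g a ha
  rw [α.θ_comp g⁻¹ g a ha h, inv_mul_cancel, α.θ_one]

theorem continuousOn_θ (α : CStarPartialAction G A) (g : G) :
    ContinuousOn (α.θ g) (α.I g⁻¹) := by
  refine LipschitzOnWith.continuousOn (K := 1) (LipschitzOnWith.of_dist_le_mul ?_)
  intro x hx y hy
  rw [dist_eq_norm, ← α.θ_sub g hx hy, α.norm_θ g (α.sub_mem _ hx hy), dist_eq_norm]
  simp

end Basic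

end CStarPartialAction

/-- Every element of a closed star subalgebra `S` lies in the closure of its right multiples by
elements of `S`. -/
theorem NonUnitalStarSubalgebra.mem_closure_image_mul_left {A : Type*} [NonUnitalCStarAlgebra A]
    (S : NonUnitalStarSubalgebra ℂ A) (hS : IsClosed (S : Set A)) {x : A} (hx : x ∈ S) :
    x ∈ closure ((fun e => x * e) '' (S : Set A)) := by
  let _ : PartialOrder S := CStarAlgebra.spectralOrder S
  have : StarOrderedRing S := CStarAlgebra.spectralOrderedRing S
  have h := (CStarAlgebra.increasingApproximateUnit S).tendsto_mul_left ⟨x, hx⟩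
  have h' : Tendsto (fun e : S => x * (e : A)) (CStarAlgebra.approximateUnit S) (𝓝 x) :=
    (continuous_subtype_val.tendsto _).comp h
  exact mem_closure_of_tendsto h' (.of_forall fun e => ⟨e, e.2, rfl⟩)

theorem IsEquivariantMap.mem {G : Type*} [Group G] {A B : Type*}
    [NonUnitalNormedRing A] [StarRing A] [Module ℂ A]
    [NonUnitalNormedRing B] [StarRing B] [Module ℂ B]
    {α : CStarPartialAction G A} {β : CStarPartialAction G B} {φ : A → B}
    (h : IsEquivariantMap α β φ) {g : G} {a : A} (ha : a ∈ α.I g) : φ a ∈ β.I g :=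
  h.1 g ⟨a, ha, rfl⟩

namespace CStarPartialAction

section Limit

variable {G : Type*} [Group G] {A : ℕ → Type*} [∀ i, NonUnitalCStarAlgebra (A i)]
  {L : Type*} [NonUnitalCStarAlgebra L]

/-- The closure of the union of the images of the ideals `A⁽ⁱ⁾_g`. -/
def limitIdeal (pa : ∀ i, CStarPartialAction G (A i)) (μ : ∀ i, A i →⋆ₙₐ[ℂ] L) (g : G) : Set L :=
  closure (⋃ i, μ i '' (pa i).I g)

/-- The union of the images in `L × L` of the graphs of the maps `α⁽ⁱ⁾_g`. -/
def algebraicGraph (pa : ∀ i, CStarPartialAction G (A i)) (μ : ∀ i, A i →⋆ₙₐ[ℂ] L) (g : G) :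
    Set (L × L) :=
  ⋃ i, (fun a => (μ i a, μ i ((pa i).θ g a))) '' (pa i).I g⁻¹

/-- The closure of `algebraicGraph`; it is the graph of the limit map `α_g`. -/
def limitGraph (pa : ∀ i, CStarPartialAction G (A i)) (μ : ∀ i, A i →⋆ₙₐ[ℂ] L) (g : G) :
    Set (L × L) :=
  closure (algebraicGraph pa μ g)

/-- `(L, μ)` receives the sequence `pa` compatibly with equivariant transition maps, has dense
union of images, and the maps `α⁽ⁱ⁾_g` preserve the norms of images in `L`. -/
structure IsLimit (pa : ∀ i, CStarPartialAction G (A i)) (μ : ∀ i, A i →⋆ₙₐ[ℂ] L) : Prop where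
  exists_transition : ∀ i j, i ≤ j →
    ∃ ψ : A i →⋆ₙₐ[ℂ] A j, IsEquivariantMap (pa i) (pa j) ψ ∧ ∀ a, μ j (ψ a) = μ i a
  dense : closure (⋃ i, Set.range (μ i)) = Set.univ
  norm_θ : ∀ g i, ∀ a ∈ (pa i).I g⁻¹, ‖μ i ((pa i).θ g a)‖ = ‖μ i a‖

variable {pa : ∀ i, CStarPartialAction G (A i)} {μ : ∀ i, A i →⋆ₙₐ[ℂ] L}

theorem mem_algebraicGraph {g : G} {i : ℕ} {a : A i} (ha : a ∈ (pa i).I g⁻¹) :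
    (μ i a, μ i ((pa i).θ g a)) ∈ algebraicGraph pa μ g :=
  Set.mem_iUnion.2 ⟨i, a, ha, rfl⟩

theorem mem_limitGraph {g : G} {i : ℕ} {a : A i} (ha : a ∈ (pa i).I g⁻¹) :
    (μ i a, μ i ((pa i).θ g a)) ∈ limitGraph pa μ g :=
  subset_closure (mem_algebraicGraph ha)

theorem mem_limitIdeal {g : G} {i : ℕ} {a : A i} (ha : a ∈ (pa i).I g) :
    μ i a ∈ limitIdeal pa μ g :=
  subset_closure (Set.mem_iUnion.2 ⟨i, a, ha, rfl⟩)

theorem zero_mem_limitIdeal (g : G) : (0 : L) ∈ limitIdeal pa μ g := by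
  simpa using mem_limitIdeal (μ := μ) ((pa 0).zero_mem g)

theorem isClosed_limitGraph (g : G) : IsClosed (limitGraph pa μ g) := isClosed_closure

theorem limitGraph_unary (g : G) (f : L → L) (hf : Continuous f)
    (h : ∀ i, ∀ a ∈ (pa i).I g⁻¹, ∃ c ∈ (pa i).I g⁻¹,
      μ i c = f (μ i a) ∧ μ i ((pa i).θ g c) = f (μ i ((pa i).θ g a)))
    {p : L × L} (hp : p ∈ limitGraph pa μ g) : (f p.1, f p.2) ∈ limitGraph pa μ g := by
  refine map_mem_closure (f := fun p : L × L => (f p.1, f p.2)) (by fun_prop) hp ?_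
  rintro _ hp
  obtain ⟨i, a, ha, rfl⟩ := Set.mem_iUnion.1 hp
  obtain ⟨c, hc, h1, h2⟩ := h i a ha
  simp only [← h1, ← h2]
  exact mem_algebraicGraph hc

theorem limitGraph_smul (g : G) (c : ℂ) {p : L × L} (hp : p ∈ limitGraph pa μ g) :
    (c • p.1, c • p.2) ∈ limitGraph pa μ g := by
  refine limitGraph_unary g (c • ·) (by fun_prop) (fun i a ha => ?_) hp
  exact ⟨_, (pa i).smul_mem _ c a ha, map_smul _ _ _, by
    rw [(pa i).θ_smul g c a ha, map_smul]⟩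

theorem limitGraph_star (g : G) {p : L × L} (hp : p ∈ limitGraph pa μ g) :
    (star p.1, star p.2) ∈ limitGraph pa μ g := by
  refine limitGraph_unary g star (by fun_prop) (fun i a ha => ?_) hp
  exact ⟨_, (pa i).star_mem _ a ha, map_star _ _, by
    rw [(pa i).θ_star g a ha, map_star]⟩

theorem limitGraph_swap {g : G} {p : L × L} (hp : p ∈ limitGraph pa μ g) :
    (p.2, p.1) ∈ limitGraph pa μ g⁻¹ := by
  refine map_mem_closure (f := fun p : L × L => (p.2, p.1)) (by fun_prop) hp ?_
  rintro _ hp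
  obtain ⟨i, a, ha, rfl⟩ := Set.mem_iUnion.1 hp
  have h := mem_algebraicGraph (μ := μ) (g := g⁻¹) (a := (pa i).θ g a)
    (by simpa using (pa i).mapsTo g a ha)
  rwa [(pa i).θ_inv_θ g ha] at h

theorem fst_mem_of_mem_limitGraph {g : G} {p : L × L} (hp : p ∈ limitGraph pa μ g) :
    p.1 ∈ limitIdeal pa μ g⁻¹ := by
  refine map_mem_closure continuous_fst hp ?_
  rintro _ hp
  obtain ⟨i, a, ha, rfl⟩ := Set.mem_iUnion.1 hp
  exact Set.mem_iUnion.2 ⟨i, a, ha, rfl⟩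

theorem snd_mem_of_mem_limitGraph {g : G} {p : L × L} (hp : p ∈ limitGraph pa μ g) :
    p.2 ∈ limitIdeal pa μ g := by
  simpa using fst_mem_of_mem_limitGraph (limitGraph_swap hp)

namespace IsLimit

variable (H : IsLimit pa μ)
include H

theorem exists_lift {g : G} {i j : ℕ} (hij : i ≤ j) {a : A i} (ha : a ∈ (pa i).I g) :
    ∃ a' ∈ (pa j).I g, μ j a' = μ i a := by
  obtain ⟨ψ, hψ, hμ⟩ := H.exists_transition i j hij
  exact ⟨ψ a, hψ.mem ha, hμ a⟩

theorem exists_lift_graph {g : G} {i j : ℕ} (hij : i ≤ j) {a : A i} (ha : a ∈ (pa i).I g⁻¹) :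
    ∃ a' ∈ (pa j).I g⁻¹, μ j a' = μ i a ∧ μ j ((pa j).θ g a') = μ i ((pa i).θ g a) := by
  obtain ⟨ψ, hψ, hμ⟩ := H.exists_transition i j hij
  exact ⟨ψ a, hψ.mem ha, hμ a, by rw [← hψ.2 g a ha, hμ]⟩

theorem limitIdeal_one : limitIdeal pa μ 1 = Set.univ := by
  simp [limitIdeal, I_one, H.dense]

theorem norm_eq {g : G} {p : L × L} (hp : p ∈ limitGraph pa μ g) : ‖p.2‖ = ‖p.1‖ := by
  refine closure_minimal (t := {p : L × L | ‖p.2‖ = ‖p.1‖}) ?_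
    (isClosed_eq (by fun_prop) (by fun_prop)) hp
  rintro _ hp
  obtain ⟨i, a, ha, rfl⟩ := Set.mem_iUnion.1 hp
  exact H.norm_θ g i a ha

theorem limitGraph_binary (g : G) (f : L → L → L) (hf : Continuous (Function.uncurry f))
    (h : ∀ i, ∀ a ∈ (pa i).I g⁻¹, ∀ b ∈ (pa i).I g⁻¹, ∃ c ∈ (pa i).I g⁻¹,
      μ i c = f (μ i a) (μ i b) ∧
        μ i ((pa i).θ g c) = f (μ i ((pa i).θ g a)) (μ i ((pa i).θ g b)))
    {p q : L × L} (hp : p ∈ limitGraph pa μ g) (hq : q ∈ limitGraph pa μ g) :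
    (f p.1 q.1, f p.2 q.2) ∈ limitGraph pa μ g := by
  refine map_mem_closure₂ (f := fun p q : L × L => (f p.1 q.1, f p.2 q.2)) (by fun_prop) hp hq ?_
  intro p hp q hq
  obtain ⟨i, a, ha, rfl⟩ := Set.mem_iUnion.1 hp
  obtain ⟨j, b, hb, rfl⟩ := Set.mem_iUnion.1 hq
  obtain ⟨a', ha', ha1, ha2⟩ := H.exists_lift_graph (le_max_left i j) ha
  obtain ⟨b', hb', hb1, hb2⟩ := H.exists_lift_graph (le_max_right i j) hb
  obtain ⟨c, hc, h1, h2⟩ := h _ a' ha' b' hb'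
  simp only [← ha1, ← ha2, ← hb1, ← hb2, ← h1, ← h2]
  exact mem_algebraicGraph hc

theorem limitGraph_add {g : G} {p q : L × L} (hp : p ∈ limitGraph pa μ g)
    (hq : q ∈ limitGraph pa μ g) : (p.1 + q.1, p.2 + q.2) ∈ limitGraph pa μ g := by
  refine H.limitGraph_binary g (· + ·) (by fun_prop) (fun i a ha b hb => ?_) hp hq
  exact ⟨_, (pa i).add_mem _ a ha b hb, map_add _ _ _, by
    rw [(pa i).θ_add g a ha b hb, map_add]⟩

theorem limitGraph_sub {g : G} {p q : L × L} (hp : p ∈ limitGraph pa μ g)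
    (hq : q ∈ limitGraph pa μ g) : (p.1 - q.1, p.2 - q.2) ∈ limitGraph pa μ g := by
  refine H.limitGraph_binary g (· - ·) (by fun_prop) (fun i a ha b hb => ?_) hp hq
  exact ⟨_, (pa i).sub_mem _ ha hb, map_sub _ _ _, by
    rw [(pa i).θ_sub g ha hb, map_sub]⟩

theorem limitGraph_mul {g : G} {p q : L × L} (hp : p ∈ limitGraph pa μ g)
    (hq : q ∈ limitGraph pa μ g) : (p.1 * q.1, p.2 * q.2) ∈ limitGraph pa μ g := by
  refine H.limitGraph_binary g (· * ·) (by fun_prop) (fun i a ha b hb => ?_) hp hq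
  exact ⟨_, (pa i).mul_mem_left _ a b hb, map_mul _ _ _, by
    rw [(pa i).θ_mul g a ha b hb, map_mul]⟩

theorem norm_sub_eq {g : G} {p q : L × L} (hp : p ∈ limitGraph pa μ g)
    (hq : q ∈ limitGraph pa μ g) : ‖p.2 - q.2‖ = ‖p.1 - q.1‖ :=
  H.norm_eq (H.limitGraph_sub hp hq)

theorem snd_unique {g : G} {x y y' : L} (hy : (x, y) ∈ limitGraph pa μ g)
    (hy' : (x, y') ∈ limitGraph pa μ g) : y = y' := by
  simpa [sub_eq_zero] using H.norm_sub_eq hy hy'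

theorem fst_unique {g : G} {x x' y : L} (hx : (x, y) ∈ limitGraph pa μ g)
    (hx' : (x', y) ∈ limitGraph pa μ g) : x = x' :=
  H.snd_unique (limitGraph_swap hx) (limitGraph_swap hx')

theorem exists_snd {g : G} {x : L} (hx : x ∈ limitIdeal pa μ g⁻¹) :
    ∃ y, (x, y) ∈ limitGraph pa μ g := by
  obtain ⟨u, hu, hux⟩ := mem_closure_iff_seq_limit.1 hx
  have hv : ∀ n, ∃ v, (u n, v) ∈ limitGraph pa μ g := fun n => by
    obtain ⟨i, a, ha, h⟩ := Set.mem_iUnion.1 (hu n)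
    exact ⟨_, h ▸ mem_limitGraph ha⟩
  choose v hv using hv
  have hcauchy : CauchySeq v := by
    have h := hux.cauchySeq
    rw [Metric.cauchySeq_iff] at h ⊢
    intro ε hε
    obtain ⟨N, hN⟩ := h ε hε
    refine ⟨N, fun m hm n hn => ?_⟩
    have := hN m hm n hn
    rwa [dist_eq_norm, ← H.norm_sub_eq (hv m) (hv n), ← dist_eq_norm] at this
  obtain ⟨y, hy⟩ := cauchySeq_tendsto_of_complete hcauchy
  exact ⟨y, (isClosed_limitGraph g).mem_of_tendsto (hux.prodMk_nhds hy) (.of_forall hv)⟩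

theorem mul_mem_closure_inter {g h : G} {x y : L} (hx : x ∈ limitIdeal pa μ g)
    (hy : y ∈ limitIdeal pa μ h) :
    x * y ∈ closure (⋃ i, μ i '' ((pa i).I g ∩ (pa i).I h)) := by
  refine map_mem_closure₂ (f := fun x y : L => x * y) (by fun_prop) hx hy ?_
  intro x hx y hy
  obtain ⟨i, a, ha, rfl⟩ := Set.mem_iUnion.1 hx
  obtain ⟨j, b, hb, rfl⟩ := Set.mem_iUnion.1 hy
  obtain ⟨a', ha', hae⟩ := H.exists_lift (le_max_left i j) ha
  obtain ⟨b', hb', hbe⟩ := H.exists_lift (le_max_right i j) hb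
  refine Set.mem_iUnion.2 ⟨max i j, a' * b', ⟨?_, ?_⟩, by rw [map_mul, hae, hbe]⟩
  · exact (pa _).mul_mem_right _ _ _ ha'
  · exact (pa _).mul_mem_left _ _ _ hb'

theorem mul_mem_left {g : G} (x : L) {y : L} (hy : y ∈ limitIdeal pa μ g) :
    x * y ∈ limitIdeal pa μ g := by
  have hx : x ∈ limitIdeal pa μ 1 := H.limitIdeal_one ▸ Set.mem_univ x
  exact closure_mono (Set.iUnion_mono fun i => Set.image_mono Set.inter_subset_right)
    (H.mul_mem_closure_inter hx hy)

theorem mul_mem_right {g : G} (x : L) {y : L} (hy : y ∈ limitIdeal pa μ g) :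
    y * x ∈ limitIdeal pa μ g := by
  have hx : x ∈ limitIdeal pa μ 1 := H.limitIdeal_one ▸ Set.mem_univ x
  exact closure_mono (Set.iUnion_mono fun i => Set.image_mono Set.inter_subset_left)
    (H.mul_mem_closure_inter hy hx)

theorem limitIdeal_binary {f : L → L → L}
    (h : ∀ (g : G) {p q : L × L}, p ∈ limitGraph pa μ g → q ∈ limitGraph pa μ g →
      (f p.1 q.1, f p.2 q.2) ∈ limitGraph pa μ g)
    {g : G} {x y : L} (hx : x ∈ limitIdeal pa μ g) (hy : y ∈ limitIdeal pa μ g) :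
    f x y ∈ limitIdeal pa μ g := by
  rw [← inv_inv g] at hx hy ⊢
  obtain ⟨_, hx⟩ := H.exists_snd hx
  obtain ⟨_, hy⟩ := H.exists_snd hy
  exact fst_mem_of_mem_limitGraph (h _ hx hy)

theorem add_mem {g : G} {x y : L} (hx : x ∈ limitIdeal pa μ g) (hy : y ∈ limitIdeal pa μ g) :
    x + y ∈ limitIdeal pa μ g :=
  H.limitIdeal_binary (fun _ _ _ => H.limitGraph_add) hx hy

theorem smul_mem {g : G} (c : ℂ) {x : L} (hx : x ∈ limitIdeal pa μ g) :
    c • x ∈ limitIdeal pa μ g :=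
  H.limitIdeal_binary (f := fun x _ => c • x) (fun _ _ _ hp _ => limitGraph_smul _ c hp) hx hx

theorem star_mem {g : G} {x : L} (hx : x ∈ limitIdeal pa μ g) : star x ∈ limitIdeal pa μ g :=
  H.limitIdeal_binary (f := fun x _ => star x) (fun _ _ _ hp _ => limitGraph_star _ hp) hx hx

/-- The limit ideal as a non-unital star subalgebra. -/
def limitSubalgebra (g : G) : NonUnitalStarSubalgebra ℂ L where
  carrier := limitIdeal pa μ g
  add_mem' := H.add_mem
  zero_mem' := zero_mem_limitIdeal g
  mul_mem' _ hb := H.mul_mem_left _ hb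
  smul_mem' c _ := H.smul_mem c
  star_mem' := H.star_mem

theorem mem_closure_inter {g h : G} {x : L} (hg : x ∈ limitIdeal pa μ g)
    (hh : x ∈ limitIdeal pa μ h) :
    x ∈ closure (⋃ i, μ i '' ((pa i).I g ∩ (pa i).I h)) := by
  refine closure_minimal ?_ isClosed_closure
    ((H.limitSubalgebra h).mem_closure_image_mul_left isClosed_closure hh)
  rintro _ ⟨e, he, rfl⟩
  exact H.mul_mem_closure_inter hg he

theorem limitGraph_comp {g h : G} {x y z : L} (hxy : (x, y) ∈ limitGraph pa μ h)
    (hyz : (y, z) ∈ limitGraph pa μ g) : (x, z) ∈ limitGraph pa μ (g * h) := by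
  have hy : y ∈ closure (⋃ i, μ i '' ((pa i).I h ∩ (pa i).I g⁻¹)) :=
    H.mem_closure_inter (snd_mem_of_mem_limitGraph hxy) (fst_mem_of_mem_limitGraph hyz)
  refine Metric.mem_closure_iff.2 fun ε hε => ?_
  obtain ⟨_, hb, hyb⟩ := Metric.mem_closure_iff.1 hy ε hε
  obtain ⟨i, b, ⟨hbh, hbg⟩, rfl⟩ := Set.mem_iUnion.1 hb
  obtain ⟨a, ha, rfl⟩ := (pa i).θ_surjOn h b hbh
  have hmem := (pa i).mem_comp g h a ha hbg
  refine ⟨_, mem_algebraicGraph hmem, ?_⟩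
  rw [← (pa i).θ_comp g h a ha hbg, Prod.dist_eq, max_lt_iff, dist_eq_norm, dist_eq_norm]
  rw [dist_eq_norm] at hyb
  exact ⟨by rwa [← H.norm_sub_eq hxy (mem_limitGraph ha)],
    by rwa [H.norm_sub_eq hyz (mem_limitGraph hbg)]⟩

open Classical in
/-- The limit of the maps `α⁽ⁱ⁾_g`, extended by zero outside the limit ideal. -/
noncomputable def limitMap (g : G) (x : L) : L :=
  if hx : x ∈ limitIdeal pa μ g⁻¹ then (H.exists_snd hx).choose else 0

theorem limitMap_spec {g : G} {x : L} (hx : x ∈ limitIdeal pa μ g⁻¹) :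
    (x, H.limitMap g x) ∈ limitGraph pa μ g := by
  rw [limitMap, dif_pos hx]
  exact (H.exists_snd hx).choose_spec

theorem limitMap_eq {g : G} {x y : L} (h : (x, y) ∈ limitGraph pa μ g) : H.limitMap g x = y :=
  H.snd_unique (H.limitMap_spec (fst_mem_of_mem_limitGraph h)) h

theorem limitGraph_one (x : L) : (x, x) ∈ limitGraph pa μ 1 := by
  have hx : x ∈ limitIdeal pa μ 1 := H.limitIdeal_one ▸ Set.mem_univ x
  refine map_mem_closure (f := fun x : L => (x, x)) (by fun_prop) hx ?_
  rintro _ hx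
  obtain ⟨i, a, -, rfl⟩ := Set.mem_iUnion.1 hx
  have h := mem_algebraicGraph (pa := pa) (μ := μ) (g := 1) (a := a) (by simp [I_one])
  rwa [θ_one] at h

/-- The partial action on the limit induced by the partial actions `α⁽ⁱ⁾`. -/
noncomputable def limit : CStarPartialAction G L where
  I := limitIdeal pa μ
  isClosed _ := isClosed_closure
  zero_mem := zero_mem_limitIdeal
  add_mem _ _ ha _ hb := H.add_mem ha hb
  smul_mem _ c _ ha := H.smul_mem c ha
  mul_mem_left _ x _ ha := H.mul_mem_left x ha
  mul_mem_right _ x _ ha := H.mul_mem_right x ha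
  star_mem _ _ ha := H.star_mem ha
  θ := H.limitMap
  mapsTo _ _ ha := snd_mem_of_mem_limitGraph (H.limitMap_spec ha)
  θ_add _ _ ha _ hb := H.limitMap_eq (H.limitGraph_add (H.limitMap_spec ha) (H.limitMap_spec hb))
  θ_smul g c _ ha := H.limitMap_eq (limitGraph_smul g c (H.limitMap_spec ha))
  θ_mul _ _ ha _ hb := H.limitMap_eq (H.limitGraph_mul (H.limitMap_spec ha) (H.limitMap_spec hb))
  θ_star g _ ha := H.limitMap_eq (limitGraph_star g (H.limitMap_spec ha))
  θ_surjOn g b hb := by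
    rw [← inv_inv g] at hb
    obtain ⟨a, ha⟩ := H.exists_snd hb
    have hab : (a, b) ∈ limitGraph pa μ g := by simpa using limitGraph_swap ha
    exact ⟨a, fst_mem_of_mem_limitGraph hab, H.limitMap_eq hab⟩
  θ_injOn _ _ ha _ hb hab := H.fst_unique (H.limitMap_spec ha) (hab ▸ H.limitMap_spec hb)
  I_one := H.limitIdeal_one
  θ_one a := H.limitMap_eq (H.limitGraph_one a)
  mem_comp _ _ _ hx hy :=
    fst_mem_of_mem_limitGraph (H.limitGraph_comp (H.limitMap_spec hx) (H.limitMap_spec hy))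
  θ_comp _ _ _ hx hy :=
    (H.limitMap_eq (H.limitGraph_comp (H.limitMap_spec hx) (H.limitMap_spec hy))).symm

end IsLimit

theorem isEquivariantMap_iterMap {φ : ∀ i, A i →⋆ₙₐ[ℂ] A (i + 1)}
    (hφ : ∀ i, IsEquivariantMap (pa i) (pa (i + 1)) (φ i)) (i j : ℕ) :
    IsEquivariantMap (pa i) (pa (i + j)) (iterMap (fun i => ⇑(φ i)) i j) := by
  induction j with
  | zero => exact ⟨fun g => (Set.image_id _).subset, fun _ _ _ => rfl⟩
  | succ j ih =>
    refine ⟨fun g => ?_, fun g a ha => ?_⟩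
    · rintro _ ⟨a, ha, rfl⟩
      exact (hφ (i + j)).mem (ih.mem ha)
    · change φ (i + j) (iterMap _ i j _) = (pa (i + j + 1)).θ g (φ (i + j) (iterMap _ i j a))
      rw [ih.2 g a ha, (hφ (i + j)).2 g _ (ih.mem ha)]

theorem exists_equivariant_transition {φ : ∀ i, A i →⋆ₙₐ[ℂ] A (i + 1)}
    (hφ : ∀ i, IsEquivariantMap (pa i) (pa (i + 1)) (φ i))
    (hμφ : ∀ i (a : A i), μ (i + 1) (φ i a) = μ i a) {i j : ℕ} (hij : i ≤ j) :
    ∃ ψ : A i →⋆ₙₐ[ℂ] A j, IsEquivariantMap (pa i) (pa j) ψ ∧ ∀ a, μ j (ψ a) = μ i a := by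
  induction j, hij using Nat.le_induction with
  | base =>
    exact ⟨NonUnitalStarAlgHom.id ℂ (A i), ⟨fun g => (Set.image_id _).subset, fun _ _ _ => rfl⟩,
      fun _ => rfl⟩
  | succ j hij ih =>
    obtain ⟨ψ, hψ, hμψ⟩ := ih
    refine ⟨(φ j).comp ψ, ⟨fun g => ?_, fun g a ha => ?_⟩, fun a => ?_⟩
    · rintro _ ⟨a, ha, rfl⟩
      exact (hφ j).mem (hψ.mem ha)
    · simp only [NonUnitalStarAlgHom.comp_apply]
      rw [hψ.2 g a ha, (hφ j).2 g _ (hψ.mem ha)]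
    · rw [NonUnitalStarAlgHom.comp_apply, hμφ, hμψ]

theorem isLimit_of_tendsto_norm {φ : ∀ i, A i →⋆ₙₐ[ℂ] A (i + 1)}
    (hφ : ∀ i, IsEquivariantMap (pa i) (pa (i + 1)) (φ i))
    (hμφ : ∀ i (a : A i), μ (i + 1) (φ i a) = μ i a)
    (hdense : closure (⋃ i, Set.range (μ i)) = Set.univ)
    (hnorm : ∀ i (a : A i),
      Tendsto (fun j => ‖iterMap (fun i => ⇑(φ i)) i j a‖) atTop (𝓝 ‖μ i a‖)) :
    IsLimit pa μ where
  exists_transition _ _ hij := exists_equivariant_transition hφ hμφ hij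
  dense := hdense
  norm_θ g i a ha := by
    refine tendsto_nhds_unique (hnorm i _) ((hnorm i a).congr fun j => ?_)
    have h := isEquivariantMap_iterMap hφ i j
    rw [h.2 g a ha, (pa (i + j)).norm_θ g (h.mem ha)]

end Limit

end CStarPartialAction

end

/-- Given an inductive sequence of partial dynamical systems
`((A i, G, pa i), φ i)` and a concrete inductive limit `(L, μ)` of the underlying
inductive sequence of C*-algebras, there is a unique partial action `α` of `G` on `L`
whose ideals are `closure (⋃ i, μ i '' (pa i).I g)` and which satisfies
`α_g (μ i a) = μ i (α⁽ⁱ⁾_g a)` for `a ∈ A⁽ⁱ⁾_{g⁻¹}` (uniqueness meaning: the ideals agree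
and the maps agree on the ideals). -/
theorem inductive_limit_partial_action_exists_unique
    {G : Type*} [Group G]
    {A : ℕ → Type*} [∀ i, NonUnitalCStarAlgebra (A i)]
    {L : Type*} [NonUnitalCStarAlgebra L]
    (pa : ∀ i, CStarPartialAction G (A i))
    (φ : ∀ i, A i →⋆ₙₐ[ℂ] A (i + 1))
    (hφ : ∀ i, IsEquivariantMap (pa i) (pa (i + 1)) (φ i))
    (μ : ∀ i, A i →⋆ₙₐ[ℂ] L)
    (hμφ : ∀ i (a : A i), μ (i + 1) (φ i a) = μ i a)
    (hdense : closure (⋃ i, Set.range (μ i)) = Set.univ)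
    (hnorm : ∀ i (a : A i),
      Filter.Tendsto (fun j => ‖iterMap (fun i => ⇑(φ i)) i j a‖) Filter.atTop
        (nhds ‖μ i a‖)) :
    ∃ α : CStarPartialAction G L,
      ((∀ g, α.I g = closure (⋃ i, μ i '' (pa i).I g)) ∧
        ∀ (g : G) (i : ℕ), ∀ a ∈ (pa i).I g⁻¹, α.θ g (μ i a) = μ i ((pa i).θ g a)) ∧
      ∀ β : CStarPartialAction G L,
        ((∀ g, β.I g = closure (⋃ i, μ i '' (pa i).I g)) ∧
          ∀ (g : G) (i : ℕ), ∀ a ∈ (pa i).I g⁻¹, β.θ g (μ i a) = μ i ((pa i).θ g a)) →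
        (∀ g, β.I g = α.I g) ∧ ∀ g, ∀ a ∈ α.I g⁻¹, β.θ g a = α.θ g a := by
  have H : CStarPartialAction.IsLimit pa μ :=
    CStarPartialAction.isLimit_of_tendsto_norm hφ hμφ hdense hnorm
  refine ⟨H.limit, ⟨fun _ => rfl, fun g i a ha =>
    H.limitMap_eq (CStarPartialAction.mem_limitGraph ha)⟩, fun β hβ => ⟨hβ.1, ?_⟩⟩
  intro g
  have hI : β.I g⁻¹ = H.limit.I g⁻¹ := hβ.1 g⁻¹
  refine Set.EqOn.of_subset_closure (s := ⋃ i, μ i '' (pa i).I g⁻¹) ?_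
    (hI ▸ β.continuousOn_θ g) (H.limit.continuousOn_θ g) subset_closure subset_rfl
  intro x hx
  obtain ⟨i, a, ha, rfl⟩ := Set.mem_iUnion.1 hx
  exact (hβ.2 g i a ha).trans (H.limitMap_eq (CStarPartialAction.mem_limitGraph ha)).symm
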